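/- Let ⊢ Γ be a classical 𝓛_C-sequent. Then ⊢ Γ is provable in ELLW if and only if the intuitionistic sequent Γ^[⊥] ⊢ (with empty stoup) is provable in IEZW. -/

import Mathlib

namespace Affine

/-- Intuitionistic formulas: the language 𝓛 (⊗, ⊸, &, ⊕, !, 1, ⊤, ⊥, 0)
together with the extra ILAL modality §. -/
inductive IForm : Type where
  | var (n : ℕ)
  | one
  | top
  | bot
  | zero
  | tensor (A B : IForm)
  | limp (A B : IForm)
  | and (A B : IForm)
  | or (A B : IForm)
  | bang (A : IForm)
  | para (A : IForm)

namespace IForm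

/-- membership in the language 𝓛 (no §) -/
def inL : IForm → Prop
  | para _ => False
  | tensor A B => inL A ∧ inL B
  | limp A B => inL A ∧ inL B
  | and A B => inL A ∧ inL B
  | or A B => inL A ∧ inL B
  | bang A => inL A
  | _ => True

/-- membership in the ⊥-free language 𝓛⁺ -/
def inLp : IForm → Prop
  | para _ => False
  | bot => False
  | tensor A B => inLp A ∧ inLp B
  | limp A B => inLp A ∧ inLp B
  | and A B => inLp A ∧ inLp B
  | or A B => inLp A ∧ inLp B
  | bang A => inLp A
  | _ => True

/-- {⊗,⊸,&,⊕,1,⊥}-formulas -/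
def inFLei : IForm → Prop
  | var _ => True
  | one => True
  | bot => True
  | tensor A B => inFLei A ∧ inFLei B
  | limp A B => inFLei A ∧ inFLei B
  | and A B => inFLei A ∧ inFLei B
  | or A B => inFLei A ∧ inFLei B
  | _ => False

/-- {⊗,⊸,&,⊕,1}-formulas -/
def inFLeiP : IForm → Prop
  | var _ => True
  | one => True
  | tensor A B => inFLeiP A ∧ inFLeiP B
  | limp A B => inFLeiP A ∧ inFLeiP B
  | and A B => inFLeiP A ∧ inFLeiP B
  | or A B => inFLeiP A ∧ inFLeiP B
  | _ => False

/-- purely implicational ({⊸}-) formulas -/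
def inImp : IForm → Prop
  | var _ => True
  | limp A B => inImp A ∧ inImp B
  | _ => False

/-- {⊸,!}-formulas -/
def inImpBang : IForm → Prop
  | var _ => True
  | limp A B => inImpBang A ∧ inImpBang B
  | bang A => inImpBang A
  | _ => False

/-- {⊸,!,§}-formulas: the language of ILAL -/
def inLAL : IForm → Prop
  | var _ => True
  | limp A B => inLAL A ∧ inLAL B
  | bang A => inLAL A
  | para A => inLAL A
  | _ => False

end IForm

/-- A parametrized intuitionistic sequent calculus: `K` is the set of allowed
formulas (the fragment), `ax` the set of non-logical axioms, and the remaining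
fields tell which optional rules are available. -/
structure ICalc where
  K : IForm → Prop
  ax : Set IForm
  wL : Prop      -- unrestricted left weakening (W)
  wR : Prop      -- right weakening (W')
  bD : Prop      -- dereliction (!D)
  bP : Prop      -- promotion (!P)
  bF : Prop      -- functorial promotion (!F)
  bW : Prop      -- !-weakening (!W), for linear systems
  lB : Prop      -- the ILAL rule (!)
  lP : Prop      -- the ILAL rule (§)

/-- Provability of an intuitionistic sequent `Γ ⊢ X` (X a stoup) in the
parametrized calculus `C`. -/
inductive IPrv (C : ICalc) : Multiset IForm → Option IForm → Prop where
  | axiom' {B} : B ∈ C.ax → IPrv C 0 (some B)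
  | init {A} : C.K A → IPrv C {A} (some A)
  | oneR : C.K .one → IPrv C 0 (some .one)
  | botL : C.K .bot → IPrv C {.bot} none
  | topR {Γ} : C.K .top → (∀ A ∈ Γ, C.K A) → IPrv C Γ (some .top)
  | zeroL {Γ X} : C.K .zero → (∀ A ∈ Γ, C.K A) → (∀ A, X = some A → C.K A) →
      IPrv C (.zero ::ₘ Γ) X
  | cut {Γ Δ X A} : IPrv C Γ (some A) → IPrv C (A ::ₘ Δ) X → IPrv C (Γ + Δ) X
  | oneL {Γ X} : C.K .one → IPrv C Γ X → IPrv C (.one ::ₘ Γ) X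
  | botR {Γ} : C.K .bot → IPrv C Γ none → IPrv C Γ (some .bot)
  | limpL {Γ Δ X A B} : C.K (.limp A B) → IPrv C Γ (some A) → IPrv C (B ::ₘ Δ) X →
      IPrv C (.limp A B ::ₘ (Γ + Δ)) X
  | limpR {Γ A B} : C.K (.limp A B) → IPrv C (A ::ₘ Γ) (some B) →
      IPrv C Γ (some (.limp A B))
  | tensorL {Γ X A B} : C.K (.tensor A B) → IPrv C (A ::ₘ B ::ₘ Γ) X →
      IPrv C (.tensor A B ::ₘ Γ) X
  | tensorR {Γ Δ A B} : C.K (.tensor A B) → IPrv C Γ (some A) → IPrv C Δ (some B) →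
      IPrv C (Γ + Δ) (some (.tensor A B))
  | withL1 {Γ X A B} : C.K (.and A B) → IPrv C (A ::ₘ Γ) X → IPrv C (.and A B ::ₘ Γ) X
  | withL2 {Γ X A B} : C.K (.and A B) → IPrv C (B ::ₘ Γ) X → IPrv C (.and A B ::ₘ Γ) X
  | withR {Γ A B} : C.K (.and A B) → IPrv C Γ (some A) → IPrv C Γ (some B) →
      IPrv C Γ (some (.and A B))
  | plusL {Γ X A B} : C.K (.or A B) → IPrv C (A ::ₘ Γ) X → IPrv C (B ::ₘ Γ) X →
      IPrv C (.or A B ::ₘ Γ) X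
  | plusR1 {Γ A B} : C.K (.or A B) → IPrv C Γ (some A) → IPrv C Γ (some (.or A B))
  | plusR2 {Γ A B} : C.K (.or A B) → IPrv C Γ (some B) → IPrv C Γ (some (.or A B))
  | bangD {Γ X A} : C.bD → C.K (.bang A) → IPrv C (A ::ₘ Γ) X → IPrv C (.bang A ::ₘ Γ) X
  | bangP {Γ : Multiset IForm} {A} : C.bP → C.K (.bang A) → (∀ B ∈ Γ, C.K (.bang B)) →
      IPrv C (Γ.map .bang) (some A) → IPrv C (Γ.map .bang) (some (.bang A))
  | bangF {Γ : Multiset IForm} {A} : C.bF → C.K (.bang A) → (∀ B ∈ Γ, C.K (.bang B)) →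
      IPrv C Γ (some A) → IPrv C (Γ.map .bang) (some (.bang A))
  | weakL {Γ X A} : C.wL → C.K A → IPrv C Γ X → IPrv C (A ::ₘ Γ) X
  | bangW {Γ X A} : C.bW → C.K (.bang A) → IPrv C Γ X → IPrv C (.bang A ::ₘ Γ) X
  | bangC {Γ X A} : C.K (.bang A) → IPrv C (.bang A ::ₘ .bang A ::ₘ Γ) X →
      IPrv C (.bang A ::ₘ Γ) X
  | weakR {Γ A} : C.wR → C.K A → IPrv C Γ none → IPrv C Γ (some A)
  | lalBang {A} {E : Multiset IForm} : C.lB → C.K (.bang A) →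
      (∀ B ∈ E, C.K (.bang B)) → Multiset.card E ≤ 1 → IPrv C E (some A) →
      IPrv C (E.map .bang) (some (.bang A))
  | lalPara {Γ Δ : Multiset IForm} {A} : C.lP → C.K (.para A) → (∀ B ∈ Γ, C.K (.bang B)) →
      (∀ B ∈ Δ, C.K (.para B)) → IPrv C (Γ + Δ) (some A) →
      IPrv C (Γ.map .bang + Δ.map .para) (some (.para A))

/-- ILZW with a set of non-logical axioms. -/
def ILZWc (Φ : Set IForm) : ICalc :=
  ⟨IForm.inL, Φ, True, False, True, True, False, False, False, False⟩

/-- ILZW' = ILZW + right weakening, with a set of non-logical axioms. -/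
def ILZWpc (Φ : Set IForm) : ICalc :=
  ⟨IForm.inL, Φ, True, True, True, True, False, False, False, False⟩

/-- ILLW: the ⊥-free fragment of ILZW. -/
def ILLWc (Φ : Set IForm) : ICalc :=
  ⟨IForm.inLp, Φ, True, False, True, True, False, False, False, False⟩

/-- IEZW: intuitionistic elementary affine logic with bottom. -/
def IEZWc (Φ : Set IForm) : ICalc :=
  ⟨IForm.inL, Φ, True, False, False, False, True, False, False, False⟩

/-- IELW: the ⊥-free fragment of IEZW. -/
def IELWc (Φ : Set IForm) : ICalc :=
  ⟨IForm.inLp, Φ, True, False, False, False, True, False, False, False⟩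

/-- FLei: the {⊗,⊸,&,⊕,1,⊥}-fragment of ILZW. -/
def FLeic (Φ : Set IForm) : ICalc :=
  ⟨IForm.inFLei, Φ, True, False, True, True, False, False, False, False⟩

/-- FLew: the {⊗,⊸,&,⊕,1,⊥}-fragment of ILZW'. -/
def FLewc (Φ : Set IForm) : ICalc :=
  ⟨IForm.inFLei, Φ, True, True, True, True, False, False, False, False⟩

/-- FLei⁺: the {⊗,⊸,&,⊕,1}-fragment of ILZW. -/
def FLeiPc (Φ : Set IForm) : ICalc :=
  ⟨IForm.inFLeiP, Φ, True, False, True, True, False, False, False, False⟩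

/-- BCK: the {⊸}-fragment of ILZW. -/
def BCKc (Φ : Set IForm) : ICalc :=
  ⟨IForm.inImp, Φ, True, False, True, True, False, False, False, False⟩

/-- The {⊸,!}-fragment of ILLW. -/
def ImpBangILLWc (Φ : Set IForm) : ICalc :=
  ⟨IForm.inImpBang, Φ, True, False, True, True, False, False, False, False⟩

/-- ILL: intuitionistic linear logic (no unrestricted weakening, only !W). -/
def ILLc (Φ : Set IForm) : ICalc :=
  ⟨IForm.inLp, Φ, False, False, True, True, False, True, False, False⟩

/-- BCI: the {⊸}-fragment of ILL. -/
def BCIc (Φ : Set IForm) : ICalc :=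
  ⟨IForm.inImp, Φ, False, False, True, True, False, True, False, False⟩

/-- ILAL: intuitionistic light affine logic. -/
def ILALc (Φ : Set IForm) : ICalc :=
  ⟨IForm.inLAL, Φ, True, False, False, False, False, False, True, True⟩

/-- Classical formulas: literals p, p⊥ and the connectives ⊗, ⅋, &, ⊕, 1, ⊥, ⊤, 0, !, ?. -/
inductive CForm : Type where
  | pos (n : ℕ)
  | neg (n : ℕ)
  | one
  | bot
  | top
  | zero
  | tensor (A B : CForm)
  | par (A B : CForm)
  | and (A B : CForm)
  | or (A B : CForm)
  | bang (A : CForm)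
  | quest (A : CForm)

namespace CForm

/-- De Morgan (involutive) negation. -/
def dual : CForm → CForm
  | pos n => neg n
  | neg n => pos n
  | one => bot
  | bot => one
  | top => zero
  | zero => top
  | tensor A B => par A.dual B.dual
  | par A B => tensor A.dual B.dual
  | and A B => or A.dual B.dual
  | or A B => and A.dual B.dual
  | bang A => quest A.dual
  | quest A => bang A.dual

/-- the propositional variable `x` occurs in the formula -/
def hasVar (x : ℕ) : CForm → Prop
  | pos n => n = x
  | neg n => n = x
  | one => False
  | bot => False
  | top => False
  | zero => False
  | tensor A B => hasVar x A ∨ hasVar x B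
  | par A B => hasVar x A ∨ hasVar x B
  | and A B => hasVar x A ∨ hasVar x B
  | or A B => hasVar x A ∨ hasVar x B
  | bang A => hasVar x A
  | quest A => hasVar x A

/-- {⊗,⅋,&,⊕,1,⊥}-formulas (the language of InFLew) -/
def inMALL : CForm → Prop
  | pos _ => True
  | neg _ => True
  | one => True
  | bot => True
  | tensor A B => inMALL A ∧ inMALL B
  | par A B => inMALL A ∧ inMALL B
  | and A B => inMALL A ∧ inMALL B
  | or A B => inMALL A ∧ inMALL B
  | _ => False

end CForm

/-- A parametrized one-sided classical sequent calculus. -/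
structure CCalc where
  K : CForm → Prop
  ax : Set CForm
  wk : Prop      -- unrestricted weakening (W)
  der : Prop     -- dereliction (?)
  prom : Prop    -- promotion (!)
  funcF : Prop   -- the functorial rule (F) of ELLW
  qW : Prop      -- ?-weakening (?W), for LL

/-- Provability of a one-sided sequent `⊢ Γ` in the parametrized calculus `C`. -/
inductive CPrv (C : CCalc) : Multiset CForm → Prop where
  | axiom' {B} : B ∈ C.ax → CPrv C {B}
  | init {A} : C.K A → C.K A.dual → CPrv C {A, A.dual}
  | one : C.K .one → CPrv C {.one}
  | top {Γ} : C.K .top → (∀ A ∈ Γ, C.K A) → CPrv C (.top ::ₘ Γ)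
  | cut {Γ Δ A} : CPrv C (A ::ₘ Γ) → CPrv C (A.dual ::ₘ Δ) → CPrv C (Γ + Δ)
  | bot {Γ} : C.K .bot → CPrv C Γ → CPrv C (.bot ::ₘ Γ)
  | tensor {Γ Δ A B} : C.K (.tensor A B) → CPrv C (A ::ₘ Γ) → CPrv C (B ::ₘ Δ) →
      CPrv C (.tensor A B ::ₘ (Γ + Δ))
  | par {Γ A B} : C.K (.par A B) → CPrv C (A ::ₘ B ::ₘ Γ) → CPrv C (.par A B ::ₘ Γ)
  | with' {Γ A B} : C.K (.and A B) → CPrv C (A ::ₘ Γ) → CPrv C (B ::ₘ Γ) →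
      CPrv C (.and A B ::ₘ Γ)
  | plus1 {Γ A B} : C.K (.or A B) → CPrv C (A ::ₘ Γ) → CPrv C (.or A B ::ₘ Γ)
  | plus2 {Γ A B} : C.K (.or A B) → CPrv C (B ::ₘ Γ) → CPrv C (.or A B ::ₘ Γ)
  | der {Γ A} : C.der → C.K (.quest A) → CPrv C (A ::ₘ Γ) → CPrv C (.quest A ::ₘ Γ)
  | prom {Γ : Multiset CForm} {A} : C.prom → C.K (.bang A) → (∀ B ∈ Γ, C.K (.quest B)) →
      CPrv C (A ::ₘ Γ.map .quest) → CPrv C (.bang A ::ₘ Γ.map .quest)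
  | wk {Γ A} : C.wk → C.K A → CPrv C Γ → CPrv C (A ::ₘ Γ)
  | questW {Γ A} : C.qW → C.K (.quest A) → CPrv C Γ → CPrv C (.quest A ::ₘ Γ)
  | questC {Γ A} : C.K (.quest A) → CPrv C (.quest A ::ₘ .quest A ::ₘ Γ) →
      CPrv C (.quest A ::ₘ Γ)
  | funcF {Γ : Multiset CForm} {A} : C.funcF → C.K (.bang A) → (∀ B ∈ Γ, C.K (.quest B)) →
      CPrv C (A ::ₘ Γ) → CPrv C (.bang A ::ₘ Γ.map .quest)

/-- LLW: classical affine logic, with a set of non-logical axioms. -/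
def LLWc (Φ : Set CForm) : CCalc :=
  ⟨fun _ => True, Φ, True, True, True, False, False⟩

/-- ELLW: classical elementary affine logic. -/
def ELLWc (Φ : Set CForm) : CCalc :=
  ⟨fun _ => True, Φ, True, False, False, True, False⟩

/-- InFLew: the {⊗,⅋,&,⊕,1,⊥}-fragment of LLW. -/
def InFLewc (Φ : Set CForm) : CCalc :=
  ⟨CForm.inMALL, Φ, True, False, False, False, False⟩

/-- LL: classical linear logic (weakening restricted to ?W). -/
def LLc (Φ : Set CForm) : CCalc :=
  ⟨fun _ => True, Φ, False, True, True, False, True⟩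

/-- The translation (·)^[F] of classical formulas into intuitionistic formulas,
where ¬_F B := B ⊸ F. -/
def trF (F : IForm) : CForm → IForm
  | .pos n => .limp (.var n) F
  | .neg n => .var n
  | .one => .limp .one F
  | .bot => .one
  | .top => .zero
  | .zero => .limp .zero F
  | .tensor B C => .limp (.limp (trF F B) F) (trF F C)
  | .par B C => .limp (.limp (trF F B) (.limp (trF F C) F)) F
  | .and B C => .or (trF F B) (trF F C)
  | .or B C => .limp (.or (.limp (trF F B) F) (.limp (trF F C) F)) F
  | .bang B => .limp (.bang (.limp (trF F B) F)) F
  | .quest B => .bang (trF F B)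

/-- The embedding (·)̲ of ⊥-free intuitionistic formulas into classical formulas. -/
def emb : IForm → CForm
  | .var n => .pos n
  | .one => .one
  | .top => .top
  | .bot => .bot
  | .zero => .zero
  | .tensor A B => .tensor (emb A) (emb B)
  | .limp A B => .par (emb A).dual (emb B)
  | .and A B => .and (emb A) (emb B)
  | .or A B => .or (emb A) (emb B)
  | .bang A => .bang (emb A)
  | .para A => .bang (emb A)

end Affine

namespace Affine

open scoped Pointwise

/-! ### From the intuitionistic to the classical calculus -/

theorem CForm.dual_dual (A : CForm) : A.dual.dual = A := by
  induction A <;> simp_all [CForm.dual]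

theorem CPrv.of_eq {C : CCalc} {Γ Δ : Multiset CForm} (h : CPrv C Γ) (e : Γ = Δ) : CPrv C Δ :=
  e ▸ h

/-- The one-sided reading of a two-sided intuitionistic sequent. -/
def embSeq (Γ : Multiset IForm) (X : Option IForm) : Multiset CForm :=
  X.elim 0 (fun A => {emb A}) + Γ.map (fun A => (emb A).dual)

theorem embSeq_some (Γ : Multiset IForm) (A : IForm) :
    embSeq Γ (some A) = emb A ::ₘ Γ.map (fun A => (emb A).dual) := by
  simp [embSeq]

theorem embSeq_none (Γ : Multiset IForm) :
    embSeq Γ none = Γ.map (fun A => (emb A).dual) := by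
  simp [embSeq]

theorem embSeq_cons (A : IForm) (Γ : Multiset IForm) (X : Option IForm) :
    embSeq (A ::ₘ Γ) X = (emb A).dual ::ₘ embSeq Γ X := by
  simp [embSeq]

theorem embSeq_add (Γ Δ : Multiset IForm) (X : Option IForm) :
    embSeq (Γ + Δ) X = Γ.map (fun A => (emb A).dual) + embSeq Δ X := by
  simp only [embSeq, Multiset.map_add]
  abel

theorem cprv_embSeq {Γ : Multiset IForm} {X : Option IForm} (h : IPrv (IEZWc ∅) Γ X) :
    CPrv (ELLWc ∅) (embSeq Γ X) := by
  induction h with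
  | axiom' h => exact h.elim
  | init _ =>
    rw [embSeq_some]
    exact .init trivial trivial
  | oneR _ => exact .one trivial
  | botL _ => exact .one trivial
  | topR _ _ =>
    rw [embSeq_some]
    exact .top trivial fun _ _ => trivial
  | zeroL _ _ _ =>
    rw [embSeq_cons]
    exact .top trivial fun _ _ => trivial
  | cut _ _ ih₁ ih₂ =>
    rw [embSeq_some] at ih₁
    rw [embSeq_cons] at ih₂
    rw [embSeq_add]
    exact .cut ih₁ ih₂
  | oneL _ _ ih =>
    rw [embSeq_cons]
    exact .bot trivial ih
  | botR _ _ ih =>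
    rw [embSeq_none] at ih
    rw [embSeq_some]
    exact .bot trivial ih
  | limpL _ _ _ ih₁ ih₂ =>
    rw [embSeq_some] at ih₁
    rw [embSeq_cons] at ih₂
    rw [embSeq_cons, embSeq_add, emb, CForm.dual, CForm.dual_dual]
    exact .tensor trivial ih₁ ih₂
  | limpR _ _ ih =>
    rw [embSeq_cons, embSeq_some] at ih
    rw [embSeq_some]
    exact .par trivial ih
  | tensorL _ _ ih =>
    rw [embSeq_cons, embSeq_cons] at ih
    rw [embSeq_cons]
    exact .par trivial ih
  | tensorR _ _ _ ih₁ ih₂ =>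
    rw [embSeq_some] at ih₁ ih₂
    rw [embSeq_some, Multiset.map_add]
    exact .tensor trivial ih₁ ih₂
  | withL1 _ _ ih =>
    rw [embSeq_cons] at ih ⊢
    exact .plus1 trivial ih
  | withL2 _ _ ih =>
    rw [embSeq_cons] at ih ⊢
    exact .plus2 trivial ih
  | withR _ _ _ ih₁ ih₂ =>
    rw [embSeq_some] at ih₁ ih₂ ⊢
    exact .with' trivial ih₁ ih₂
  | plusL _ _ _ ih₁ ih₂ =>
    rw [embSeq_cons] at ih₁ ih₂ ⊢
    exact .with' trivial ih₁ ih₂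
  | plusR1 _ _ ih =>
    rw [embSeq_some] at ih ⊢
    exact .plus1 trivial ih
  | plusR2 _ _ ih =>
    rw [embSeq_some] at ih ⊢
    exact .plus2 trivial ih
  | bangD h => exact h.elim
  | bangP h => exact h.elim
  | bangF _ _ _ _ ih =>
    rw [embSeq_some] at ih
    refine (CPrv.funcF trivial trivial (fun _ _ => trivial) ih).of_eq ?_
    simp [embSeq_some, emb, CForm.dual, Function.comp_def]
  | weakL _ _ _ ih =>
    rw [embSeq_cons]
    exact .wk trivial trivial ih
  | bangW h => exact h.elim
  | bangC _ _ ih =>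
    rw [embSeq_cons, embSeq_cons] at ih
    rw [embSeq_cons]
    exact .questC trivial ih
  | weakR h => exact h.elim
  | lalBang h => exact h.elim
  | lalPara h => exact h.elim

/-- Tensoring with `1` preserves provability. -/
theorem CPrv.tensor_one {A : CForm} {Γ : Multiset CForm} (h : CPrv (ELLWc ∅) (A ::ₘ Γ)) :
    CPrv (ELLWc ∅) (.tensor A .one ::ₘ Γ) :=
  (CPrv.tensor (Δ := 0) trivial h (.one trivial)).of_eq (by simp)

theorem CPrv.par_bot {A : CForm} {Γ : Multiset CForm} (h : CPrv (ELLWc ∅) (A ::ₘ Γ)) :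
    CPrv (ELLWc ∅) (.par A .bot ::ₘ Γ) :=
  .par trivial ((CPrv.bot trivial h).of_eq (Multiset.cons_swap _ _ _))

theorem CPrv.swap {A B : CForm} {Γ : Multiset CForm} (h : CPrv (ELLWc ∅) (A ::ₘ B ::ₘ Γ)) :
    CPrv (ELLWc ∅) (B ::ₘ A ::ₘ Γ) :=
  h.of_eq (Multiset.cons_swap _ _ _)

/-- The translation of `A` is, classically, implied by the negation of `A`. -/
theorem cprv_emb_trF (A : CForm) :
    CPrv (ELLWc ∅) (emb (trF .bot A) ::ₘ A ::ₘ 0) := by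
  induction A with
  | pos n => exact .par_bot (.swap (.init (A := .pos n) trivial trivial))
  | neg n => exact .init (A := .pos n) trivial trivial
  | one => exact .par_bot (.bot trivial (.one trivial))
  | bot => exact .swap (.bot trivial (.one trivial))
  | top => exact .swap (.top trivial fun _ _ => trivial)
  | zero => exact .par_bot (.top trivial fun _ _ => trivial)
  | tensor B C ihB ihC =>
    simp only [trF, emb, CForm.dual, CForm.dual_dual]
    refine .par trivial (CPrv.of_eq (.tensor (A := B) (B := C) trivial
      (.swap (.tensor_one ihB)) (.swap ihC)) ?_)
    simp only [← Multiset.singleton_add]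
    abel
  | par B C ihB ihC =>
    simp only [trF, emb, CForm.dual, CForm.dual_dual]
    refine .par_bot (.swap (.par trivial (CPrv.of_eq
      (.tensor trivial ihB (.tensor_one ihC)) ?_)))
    simp only [← Multiset.singleton_add]
    abel
  | and B C ihB ihC =>
    exact .swap (.with' trivial (.swap (.plus1 trivial ihB)) (.swap (.plus2 trivial ihC)))
  | or B C ihB ihC =>
    simp only [trF, emb, CForm.dual, CForm.dual_dual]
    exact .par_bot (.with' trivial (.tensor_one (.swap (.plus1 trivial (.swap ihB))))
      (.tensor_one (.swap (.plus2 trivial (.swap ihC)))))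
  | bang B ih =>
    simp only [trF, emb, CForm.dual, CForm.dual_dual]
    exact .par_bot (.swap (.funcF (Γ := {.tensor (emb (trF .bot B)) .one}) trivial trivial
      (fun _ _ => trivial) (.swap (.tensor_one ih))))
  | quest B ih =>
    exact .funcF (Γ := {B}) trivial trivial (fun _ _ => trivial) ih

theorem CPrv.of_map_emb_trF (Γ Δ : Multiset CForm)
    (h : CPrv (ELLWc ∅) (Γ.map (fun A => (emb (trF .bot A)).dual) + Δ)) :
    CPrv (ELLWc ∅) (Γ + Δ) := by
  induction Γ using Multiset.induction generalizing Δ with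
  | empty => simpa using h
  | cons A Γ ih =>
    rw [Multiset.map_cons, Multiset.cons_add] at h
    refine (ih (A ::ₘ Δ) ((CPrv.cut (cprv_emb_trF A) h).of_eq ?_)).of_eq ?_ <;>
    · simp only [← Multiset.singleton_add]
      abel

/-! ### Sequent predicates closed under the cut-free rules -/

/-- Closure of a set of sequents under the rules of ELLW other than cut, with initial
sequents restricted to atoms. -/
structure CutFreeClosed (D : Multiset CForm → Prop) : Prop where
  atom (n : ℕ) : D {.pos n, .neg n}
  one : D {.one}
  top (Γ) : D (.top ::ₘ Γ)
  bot {Γ} : D Γ → D (.bot ::ₘ Γ)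
  tensor {Γ Δ A B} : D (A ::ₘ Γ) → D (B ::ₘ Δ) → D (.tensor A B ::ₘ (Γ + Δ))
  par {Γ A B} : D (A ::ₘ B ::ₘ Γ) → D (.par A B ::ₘ Γ)
  with' {Γ A B} : D (A ::ₘ Γ) → D (B ::ₘ Γ) → D (.and A B ::ₘ Γ)
  plus1 {Γ A B} : D (A ::ₘ Γ) → D (.or A B ::ₘ Γ)
  plus2 {Γ A B} : D (B ::ₘ Γ) → D (.or A B ::ₘ Γ)
  wk {Γ A} : D Γ → D (A ::ₘ Γ)
  questC {Γ A} : D (.quest A ::ₘ .quest A ::ₘ Γ) → D (.quest A ::ₘ Γ)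
  funcF {Γ : Multiset CForm} {A} : D (A ::ₘ Γ) → D (.bang A ::ₘ Γ.map .quest)

section Phase

variable (D : Multiset CForm → Prop)

/-- Orthogonality in the phase space of multisets of formulas with pole `D`. -/
def orth (S : Set (Multiset CForm)) : Set (Multiset CForm) :=
  {Δ | ∀ Γ ∈ S, D (Γ + Δ)}

/-- The image of a set of contexts under prefixing all formulas by `?`. -/
def questImage (S : Set (Multiset CForm)) : Set (Multiset CForm) :=
  (fun Γ => Γ.map CForm.quest) '' S

/-- The fact interpreting the negation of a formula in the phase space with pole `D`. -/
def refutations : CForm → Set (Multiset CForm)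
  | .pos n => orth D (orth D {{.pos n}})
  | .neg n => orth D {{.pos n}}
  | .one => orth D {0}
  | .bot => orth D (orth D {0})
  | .top => orth D Set.univ
  | .zero => Set.univ
  | .tensor A B => orth D (orth D (refutations A) + orth D (refutations B))
  | .par A B => orth D (orth D (refutations A + refutations B))
  | .and A B => orth D (orth D (refutations A) ∩ orth D (refutations B))
  | .or A B => refutations A ∩ refutations B
  | .bang A => orth D (questImage (orth D (refutations A)))
  | .quest A => orth D (orth D (questImage (refutations A)))

variable {D}

theorem orth_anti {S T : Set (Multiset CForm)} (h : S ⊆ T) : orth D T ⊆ orth D S :=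
  fun _ hΔ _ hΓ => hΔ _ (h hΓ)

theorem subset_orth_orth (S : Set (Multiset CForm)) : S ⊆ orth D (orth D S) :=
  fun Γ hΓ Δ hΔ => by
    rw [add_comm]
    exact hΔ Γ hΓ

theorem orth_orth_orth (S : Set (Multiset CForm)) : orth D (orth D (orth D S)) = orth D S :=
  (orth_anti (subset_orth_orth S)).antisymm (subset_orth_orth _)

theorem orth_orth_add_subset (S T : Set (Multiset CForm)) :
    orth D (orth D S) + orth D (orth D T) ⊆ orth D (orth D (S + T)) := by
  rintro _ ⟨X, hX, Y, hY, rfl⟩ Z hZ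
  have hXZ : X + Z ∈ orth D T := by
    intro Y' hY'
    have : Y' + Z ∈ orth D S := by
      intro X' hX'
      rw [← add_assoc]
      exact hZ _ (Set.add_mem_add hX' hY')
    have h := hX _ this
    rwa [add_assoc, add_comm Z] at h
  have h := hY _ hXZ
  rwa [add_comm X, add_assoc] at h

theorem questImage_mono {S T : Set (Multiset CForm)} (h : S ⊆ T) :
    questImage S ⊆ questImage T :=
  Set.image_mono h

theorem questImage_add (S T : Set (Multiset CForm)) :
    questImage (S + T) = questImage S + questImage T :=
  Set.image_add (Multiset.mapAddMonoidHom CForm.quest)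

theorem orth_orth_refutations (A : CForm) :
    orth D (orth D (refutations D A)) = refutations D A := by
  cases A with
  | zero => exact (Set.subset_univ _).antisymm (subset_orth_orth _)
  | or A B =>
    refine Set.Subset.antisymm (Set.subset_inter ?_ ?_) (subset_orth_orth _)
    · exact (orth_anti (orth_anti Set.inter_subset_left)).trans (orth_orth_refutations A).le
    · exact (orth_anti (orth_anti Set.inter_subset_right)).trans (orth_orth_refutations B).le
  | _ => exact orth_orth_orth _

theorem refutations_dual (A : CForm) :
    refutations D A.dual = orth D (refutations D A) := by
  induction A with
  | and A B ihA ihB =>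
    have h := orth_orth_refutations (D := D) (CForm.and A B).dual
    simp only [CForm.dual, refutations, ihA, ihB] at h ⊢
    exact h.symm
  | top =>
    exact ((Set.subset_univ _).antisymm (subset_orth_orth _)).symm
  | _ => simp_all [CForm.dual, refutations, orth_orth_orth, orth_orth_refutations]

theorem CutFreeClosed.singleton_mem_refutations (hD : CutFreeClosed D) (A : CForm) :
    {A} ∈ refutations D A := by
  induction A with
  | pos n => exact subset_orth_orth _ rfl
  | neg n =>
    rintro _ rfl
    exact hD.atom n
  | one =>
    rintro _ rfl
    exact hD.one
  | bot =>
    intro X hX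
    rw [add_comm]
    exact hD.bot (by simpa using hX 0 rfl)
  | top =>
    intro X _
    rw [add_comm]
    exact hD.top X
  | zero => trivial
  | tensor A B ihA ihB =>
    rintro _ ⟨X, hX, Y, hY, rfl⟩
    rw [add_comm]
    exact hD.tensor (hX _ ihA) (hY _ ihB)
  | par A B ihA ihB =>
    intro X hX
    rw [add_comm]
    exact hD.par (by simpa using hX _ (Set.add_mem_add ihA ihB))
  | and A B ihA ihB =>
    rintro X ⟨hA, hB⟩
    rw [add_comm]
    exact hD.with' (hA _ ihA) (hB _ ihB)
  | or A B ihA ihB =>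
    constructor
    · rw [← orth_orth_refutations]
      intro X hX
      rw [add_comm]
      exact hD.plus1 (hX _ ihA)
    · rw [← orth_orth_refutations]
      intro X hX
      rw [add_comm]
      exact hD.plus2 (hX _ ihB)
  | bang A ih =>
    rintro _ ⟨X, hX, rfl⟩
    rw [add_comm]
    exact hD.funcF (hX _ ih)
  | quest A ih => exact subset_orth_orth _ ⟨_, ih, rfl⟩

theorem CutFreeClosed.contract (hD : CutFreeClosed D) (Γ Δ : Multiset CForm)
    (h : D (Γ.map .quest + (Γ.map .quest + Δ))) : D (Γ.map .quest + Δ) := by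
  induction Γ using Multiset.induction generalizing Δ with
  | empty => simpa using h
  | cons A Γ ih =>
    rw [Multiset.map_cons, Multiset.cons_add]
    refine hD.questC ?_
    have := ih (.quest A ::ₘ .quest A ::ₘ Δ) (by
      convert h using 1
      simp only [Multiset.map_cons]
      simp only [← Multiset.singleton_add]
      abel)
    simpa using this

theorem CutFreeClosed.weaken (hD : CutFreeClosed D) (Γ Δ : Multiset CForm) (h : D Δ) :
    D (Γ + Δ) := by
  induction Γ using Multiset.induction with
  | empty => simpa using h
  | cons A Γ ih =>
    rw [Multiset.cons_add]
    exact hD.wk ih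

variable (D) in
/-- The contexts obtained by choosing a refutation of each formula of a sequent. -/
def seqRefutations (Γ : Multiset CForm) : Set (Multiset CForm) :=
  (Γ.map (refutations D)).sum

theorem seqRefutations_cons (A : CForm) (Γ : Multiset CForm) :
    seqRefutations D (A ::ₘ Γ) = refutations D A + seqRefutations D Γ := by
  simp [seqRefutations]

theorem seqRefutations_add (Γ Δ : Multiset CForm) :
    seqRefutations D (Γ + Δ) = seqRefutations D Γ + seqRefutations D Δ := by
  simp [seqRefutations]

theorem seqRefutations_singleton (A : CForm) :
    seqRefutations D {A} = refutations D A := by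
  simp [seqRefutations]

theorem seqRefutations_map_quest_subset (Γ : Multiset CForm) :
    seqRefutations D (Γ.map .quest) ⊆ orth D (orth D (questImage (seqRefutations D Γ))) := by
  induction Γ using Multiset.induction with
  | empty =>
    refine Set.Subset.trans ?_ (subset_orth_orth _)
    simp [seqRefutations, questImage]
  | cons A Γ ih =>
    rw [Multiset.map_cons, seqRefutations_cons, seqRefutations_cons, questImage_add]
    exact (Set.add_subset_add_left ih).trans (orth_orth_add_subset _ _)

theorem seqRefutations_cons_subset_iff (A : CForm) (Γ : Multiset CForm) :
    seqRefutations D (A ::ₘ Γ) ⊆ {Δ | D Δ} ↔ seqRefutations D Γ ⊆ orth D (refutations D A) := by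
  rw [seqRefutations_cons, Set.add_subset_iff]
  exact ⟨fun h Y hY X hX => h X hX Y hY, fun h X hX Y hY => h hY X hX⟩

theorem CutFreeClosed.seqRefutations_subset (hD : CutFreeClosed D) {Γ : Multiset CForm}
    (h : CPrv (ELLWc ∅) Γ) : seqRefutations D Γ ⊆ {Δ | D Δ} := by
  induction h with
  | axiom' h => exact h.elim
  | init _ _ =>
    rw [Multiset.insert_eq_cons, seqRefutations_cons_subset_iff, seqRefutations_singleton,
      refutations_dual]
  | one _ =>
    rw [seqRefutations_singleton]
    intro X hX
    have := hX 0 rfl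
    rwa [zero_add] at this
  | top _ _ =>
    rw [seqRefutations_cons_subset_iff]
    exact (Set.subset_univ _).trans (subset_orth_orth _)
  | cut _ _ ih₁ ih₂ =>
    rw [seqRefutations_cons_subset_iff] at ih₁ ih₂
    rw [refutations_dual] at ih₂
    rw [seqRefutations_add]
    rintro _ ⟨X, hX, Y, hY, rfl⟩
    exact ih₂ hY X (ih₁ hX)
  | bot _ _ ih =>
    rw [seqRefutations_cons_subset_iff, refutations, orth_orth_orth]
    rintro X hX _ rfl
    rw [zero_add]
    exact ih hX
  | tensor _ _ _ ih₁ ih₂ =>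
    rw [seqRefutations_cons_subset_iff] at ih₁ ih₂ ⊢
    rw [seqRefutations_add]
    exact (Set.add_subset_add ih₁ ih₂).trans (subset_orth_orth _)
  | par _ _ ih =>
    rw [seqRefutations_cons_subset_iff, refutations, orth_orth_orth]
    rintro X hX _ ⟨Y, hY, Z, hZ, rfl⟩
    rw [seqRefutations_cons, seqRefutations_cons] at ih
    have := ih (Set.add_mem_add hY (Set.add_mem_add hZ hX))
    rwa [← add_assoc] at this
  | with' _ _ _ ih₁ ih₂ =>
    rw [seqRefutations_cons_subset_iff] at ih₁ ih₂ ⊢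
    exact (Set.subset_inter ih₁ ih₂).trans (subset_orth_orth _)
  | plus1 _ _ ih =>
    rw [seqRefutations_cons_subset_iff] at ih ⊢
    exact ih.trans (orth_anti Set.inter_subset_left)
  | plus2 _ _ ih =>
    rw [seqRefutations_cons_subset_iff] at ih ⊢
    exact ih.trans (orth_anti Set.inter_subset_right)
  | der h => exact h.elim
  | prom h => exact h.elim
  | wk _ _ _ ih =>
    rw [seqRefutations_cons_subset_iff]
    exact fun X hX Y _ => hD.weaken Y X (ih hX)
  | questW h => exact h.elim
  | questC _ _ ih =>
    rw [seqRefutations_cons_subset_iff, refutations, orth_orth_orth]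
    rintro X hX _ ⟨Y, hY, rfl⟩
    rw [seqRefutations_cons, seqRefutations_cons] at ih
    have hY' : Y.map .quest ∈ refutations D (.quest _) := subset_orth_orth _ ⟨Y, hY, rfl⟩
    exact hD.contract Y X (ih (Set.add_mem_add hY' (Set.add_mem_add hY' hX)))
  | funcF _ _ _ _ ih =>
    rw [seqRefutations_cons_subset_iff] at ih ⊢
    exact (seqRefutations_map_quest_subset _).trans
      (orth_anti (orth_anti (questImage_mono ih)))

theorem CutFreeClosed.mem_seqRefutations (hD : CutFreeClosed D) (Γ : Multiset CForm) :
    Γ ∈ seqRefutations D Γ := by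
  induction Γ using Multiset.induction with
  | empty => simp [seqRefutations]
  | cons A Γ ih =>
    rw [seqRefutations_cons]
    exact Set.add_mem_add (hD.singleton_mem_refutations A) ih

/-- Cut elimination: a set of sequents closed under the cut-free rules contains all
sequents provable in ELLW. -/
theorem CutFreeClosed.of_cprv (hD : CutFreeClosed D) {Γ : Multiset CForm}
    (h : CPrv (ELLWc ∅) Γ) : D Γ :=
  hD.seqRefutations_subset h (hD.mem_seqRefutations Γ)

end Phase

/-! ### From the classical to the intuitionistic calculus -/

theorem inL_trF (A : CForm) : (trF .bot A).inL := by
  induction A <;> simp_all [trF, IForm.inL]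

theorem IPrv.neg_right {A : IForm} {Γ : Multiset IForm} (hA : A.inL)
    (h : IPrv (IEZWc ∅) (A ::ₘ Γ) none) : IPrv (IEZWc ∅) Γ (some (.limp A .bot)) :=
  .limpR ⟨hA, trivial⟩ (.botR trivial h)

theorem IPrv.neg_left {A : IForm} {Γ : Multiset IForm} (hA : A.inL)
    (h : IPrv (IEZWc ∅) Γ (some A)) : IPrv (IEZWc ∅) (.limp A .bot ::ₘ Γ) none := by
  have := IPrv.limpL (C := IEZWc ∅) (Δ := 0) (B := .bot) ⟨hA, trivial⟩ h (.botL trivial)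
  rwa [add_zero] at this

theorem cutFreeClosed_iprv :
    CutFreeClosed fun Γ => IPrv (IEZWc ∅) (Γ.map (trF .bot)) none where
  atom n := IPrv.neg_left (A := .var n) trivial (.init trivial)
  one := IPrv.neg_left (A := .one) trivial (.oneR trivial)
  top Γ := by
    rw [Multiset.map_cons]
    refine .zeroL trivial (fun A hA => ?_) (by simp)
    obtain ⟨B, _, rfl⟩ := Multiset.mem_map.1 hA
    exact inL_trF B
  bot h := by
    rw [Multiset.map_cons]
    exact .oneL trivial h
  tensor {Γ Δ A B} hA hB := by
    rw [Multiset.map_cons] at hA hB ⊢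
    rw [Multiset.map_add]
    exact .limpL (inL_trF (.tensor A B)) (.neg_right (inL_trF A) hA) hB
  par {Γ A B} h := by
    rw [Multiset.map_cons, Multiset.map_cons, Multiset.cons_swap] at h
    rw [Multiset.map_cons]
    exact .neg_left ⟨inL_trF A, inL_trF B, trivial⟩
      (.limpR ⟨inL_trF A, inL_trF B, trivial⟩
        (.neg_right (inL_trF B) h))
  with' {Γ A B} hA hB := by
    rw [Multiset.map_cons] at hA hB ⊢
    exact .plusL (inL_trF (.and A B)) hA hB
  plus1 {Γ A B} h := by
    rw [Multiset.map_cons] at h ⊢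
    exact .neg_left (inL_trF (.or A B)).1
      (.plusR1 (inL_trF (.or A B)).1 (.neg_right (inL_trF A) h))
  plus2 {Γ A B} h := by
    rw [Multiset.map_cons] at h ⊢
    exact .neg_left (inL_trF (.or A B)).1
      (.plusR2 (inL_trF (.or A B)).1 (.neg_right (inL_trF B) h))
  wk {Γ A} h := by
    rw [Multiset.map_cons]
    exact .weakL trivial (inL_trF A) h
  questC {Γ A} h := by
    rw [Multiset.map_cons, Multiset.map_cons] at h
    rw [Multiset.map_cons]
    exact .bangC (inL_trF (.quest A)) h
  funcF {Γ A} h := by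
    rw [Multiset.map_cons] at h ⊢
    have := IPrv.bangF (C := IEZWc ∅) (A := .limp (trF .bot A) .bot) trivial
      (inL_trF (.bang A)).1
      (fun B hB => by
        obtain ⟨B, _, rfl⟩ := Multiset.mem_map.1 hB
        exact inL_trF (.quest B)) (IPrv.neg_right (inL_trF A) h)
    have e : (Γ.map .quest).map (trF .bot) = (Γ.map (trF .bot)).map .bang := by
      simp [trF, Function.comp_def]
    rw [e]
    exact .neg_left (inL_trF (.bang A)).1 this

/-- `⊢ Γ` is provable in ELLW iff `Γ^[⊥] ⊢` (empty stoup) is provable in IEZW. -/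
theorem ellw_iff_iezw_translation (Γ : Multiset CForm) :
    CPrv (ELLWc ∅) Γ ↔ IPrv (IEZWc ∅) (Γ.map (trF IForm.bot)) none := by
  refine ⟨cutFreeClosed_iprv.of_cprv, fun h => ?_⟩
  refine (CPrv.of_map_emb_trF Γ 0 ((cprv_embSeq h).of_eq ?_)).of_eq (add_zero Γ)
  simp [embSeq_none]
end Affine
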